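/- Let G be a group and let N, k be natural numbers with k ≤ N + 1. Consider the set 𝓕 of k-element 'faces', i.e., pairs (s, f) where s is a subset of Fin (N+1) with |s| = k and f : s → G. The semidirect product H = (Fin (N+1) → G) ⋊ Perm(Fin (N+1)) acts on 𝓕 by ((h, π)) • (s, f) = (π(s), i ↦ f(π⁻¹(i)) · h(π⁻¹(i))), where π(s) is the image of s under the permutation π. This action of H on 𝓕 is transitive. -/

import Mathlib

/-- **Transitivity of the `(Fin (N+1) → G) ⋊ Perm (Fin (N+1))` action on
`k`-element faces of the join `EG_N = G * ⋯ * G`.**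

A `k`-element face is a pair `(s, f)` with `s ⊆ Fin (N+1)`, `|s| = k`, and
`f : s → G`, encoded here as a sigma type `(s : Finset (Fin (N+1))) × (↥s → G)`.
An element `(h, π)` of the semidirect product acts by
`(h, π) • (s, f) = (π '' s, i ↦ f (π⁻¹ i) * h (π⁻¹ i))`; equivalently, the
value of the new face at `π j` (for `j ∈ s`) is `f j * h j`.  The statement:
for any two faces `p, q` of the same cardinality `k ≤ N + 1`, there is an
element `(h, π)` carrying `p` to `q`. -/
theorem semidirectProduct_action_transitive_on_faces
    (G : Type*) [Group G] (N k : ℕ) (hk : k ≤ N + 1)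
    (p q : (s : Finset (Fin (N + 1))) × (↥s → G))
    (hp : p.1.card = k) (hq : q.1.card = k) :
    ∃ (h : Fin (N + 1) → G) (π : Equiv.Perm (Fin (N + 1)))
      (hs : q.1 = p.1.image π),
      ∀ (j : Fin (N + 1)) (hj : j ∈ p.1),
        q.2 ⟨π j, by rw [hs]; exact Finset.mem_image_of_mem π hj⟩
          = p.2 ⟨j, hj⟩ * h j := by
  let e : {x // x ∈ p.1} ≃ {x // x ∈ q.1} := Finset.equivOfCardEq (hp.trans hq.symm)
  have he (j : Fin (N + 1)) (hj : j ∈ p.1) : e.extendSubtype j = e ⟨j, hj⟩ :=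
    e.extendSubtype_apply_of_mem j hj
  have hs : q.1 = p.1.image e.extendSubtype := by
    symm
    apply Finset.eq_of_subset_of_card_le
    · exact Finset.image_subset_iff.2 fun j hj => e.extendSubtype_mem j hj
    · rw [Finset.card_image_of_injective _ e.extendSubtype.injective, hp, hq]
  refine ⟨fun j => if hj : j ∈ p.1 then (p.2 ⟨j, hj⟩)⁻¹ * q.2 (e ⟨j, hj⟩) else 1,
    e.extendSubtype, hs, fun j hj => ?_⟩
  simp only [dif_pos hj, mul_inv_cancel_left]
  exact congrArg q.2 (Subtype.ext (he j hj))
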